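/- Let G be a graph satisfying Ψ = 20^4·k^3/δ for some δ ∈ (0,1/2] with k/δ ≥ 10^9. Then, with ε = 6·10^{−7}, the normalized spectral embedding is ε-separated: Δ_k(𝒳_V) ≤ ε²·Δ_{k−1}(𝒳_V). (In particular, Δ_{k−1}(𝒳_V) ≥ 1/12 − (2δ/20^4)/k while Δ_k(𝒳_V) ≤ 2k²/Ψ.) -/

import Mathlib

open Finset BigOperators Matrix

namespace SpectralClustering

variable {V : Type} [Fintype V] [DecidableEq V]

/-- Volume of a vertex set: the sum of the degrees of its vertices. -/
def vol (G : SimpleGraph V) [DecidableRel G.Adj] (S : Finset V) : ℕ :=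
  ∑ v ∈ S, G.degree v

/-- Number of edges between two (disjoint) vertex sets. -/
def cut (G : SimpleGraph V) [DecidableRel G.Adj] (S T : Finset V) : ℕ :=
  ∑ u ∈ S, (T.filter fun v => G.Adj u v).card

/-- Conductance `φ(S) = |E(S, V \ S)| / μ(S)`. -/
noncomputable def conductance (G : SimpleGraph V) [DecidableRel G.Adj] (S : Finset V) : ℝ :=
  (cut G S Sᶜ : ℝ) / (vol G S : ℝ)

/-- A `k`-way partition of the vertex set into nonempty blocks. -/
def IsKWayPartition {k : ℕ} (P : Fin k → Finset V) : Prop :=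
  (∀ i, (P i).Nonempty) ∧ (∀ i j, i ≠ j → Disjoint (P i) (P j)) ∧
    (∀ v : V, ∃ i, v ∈ P i)

/-- Maximum conductance over the blocks of a tuple of sets. -/
noncomputable def maxCond (G : SimpleGraph V) [DecidableRel G.Adj] {k : ℕ}
    (P : Fin k → Finset V) : ℝ :=
  ⨆ i, conductance G (P i)

/-- Average conductance of the blocks. -/
noncomputable def avgCond (G : SimpleGraph V) [DecidableRel G.Adj] {k : ℕ}
    (P : Fin k → Finset V) : ℝ :=
  (∑ i, conductance G (P i)) / (k : ℝ)

/-- `P` achieves `ρ̂_avr(k)`: it minimizes the maximum conductance among all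
`k`-way partitions, and among those it has minimal average conductance. -/
def AchievesRhoAvr (G : SimpleGraph V) [DecidableRel G.Adj] {k : ℕ}
    (P : Fin k → Finset V) : Prop :=
  IsKWayPartition P ∧
  (∀ Q : Fin k → Finset V, IsKWayPartition Q → maxCond G P ≤ maxCond G Q) ∧
  (∀ Q : Fin k → Finset V, IsKWayPartition Q → maxCond G Q = maxCond G P →
    avgCond G P ≤ avgCond G Q)

/-- Dot product of two vectors indexed by the vertices. -/
def dotV (x y : V → ℝ) : ℝ := ∑ v, x v * y v

/-- The normalized Laplacian `I - D^{-1/2} A D^{-1/2}`. -/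
noncomputable def normLap (G : SimpleGraph V) [DecidableRel G.Adj] : Matrix V V ℝ :=
  1 - Matrix.diagonal (fun v => (Real.sqrt (G.degree v))⁻¹) * G.adjMatrix ℝ *
      Matrix.diagonal (fun v => (Real.sqrt (G.degree v))⁻¹)

/-- `f` is an orthonormal family of eigenvectors of the normalized Laplacian of `G`
with (sorted) eigenvalues `lam`. -/
structure EigenData (G : SimpleGraph V) [DecidableRel G.Adj]
    (f : Fin (Fintype.card V) → V → ℝ) (lam : Fin (Fintype.card V) → ℝ) : Prop where
  eig : ∀ i, (normLap G).mulVec (f i) = lam i • f i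
  ortho : ∀ i j, dotV (f i) (f j) = if i = j then (1 : ℝ) else 0
  mono : Monotone lam

/-- The gap parameter `Ψ = λ_{k+1} / ρ̂_avr(k)`, where `ρ̂_avr(k)` is realized as the
average conductance of the fixed optimal partition `P`. -/
noncomputable def Psi (G : SimpleGraph V) [DecidableRel G.Adj]
    (lam : Fin (Fintype.card V) → ℝ) {k : ℕ} (P : Fin k → Finset V)
    (hkn : k < Fintype.card V) : ℝ :=
  lam ⟨k, hkn⟩ / avgCond G P

/-- The spectral embedding `F(u) = d_u^{-1/2} (f_1(u), …, f_k(u))`. -/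
noncomputable def Femb (G : SimpleGraph V) [DecidableRel G.Adj]
    (f : Fin (Fintype.card V) → V → ℝ) {k : ℕ} (hk : k ≤ Fintype.card V) (u : V) :
    Fin k → ℝ :=
  fun j => f (Fin.castLE hk j) u / Real.sqrt (G.degree u)

/-- `k`-means cost of a clustering of the (degree-weighted) spectral embedding:
`∑_i ∑_{u ∈ A_i} d_u ‖F(u) - c_i‖²`. -/
noncomputable def kmCost (G : SimpleGraph V) [DecidableRel G.Adj]
    (f : Fin (Fintype.card V) → V → ℝ) {k : ℕ} (hk : k ≤ Fintype.card V) {ℓ : ℕ}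
    (A : Fin ℓ → Finset V) (c : Fin ℓ → Fin k → ℝ) : ℝ :=
  ∑ i, ∑ u ∈ A i, (G.degree u : ℝ) * ∑ j, (Femb G f hk u j - c i j) ^ 2

/-- `Δ_ℓ(𝒳_V)`: the optimal `ℓ`-means cost of the spectral embedding multiset `𝒳_V`
(which contains `d_u` copies of `F(u)` for every vertex `u`). -/
noncomputable def kmOpt (G : SimpleGraph V) [DecidableRel G.Adj]
    (f : Fin (Fintype.card V) → V → ℝ) {k : ℕ} (hk : k ≤ Fintype.card V) (ℓ : ℕ) : ℝ :=
  sInf { r : ℝ | ∃ (A : Fin ℓ → Finset V) (c : Fin ℓ → Fin k → ℝ),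
    (∀ i j, i ≠ j → Disjoint (A i) (A j)) ∧ (∀ v : V, ∃ i, v ∈ A i) ∧
    r = kmCost G f hk A c }

/-- Normalized characteristic vector `ḡ_i = D^{1/2} χ_{P_i} / √μ(P_i)`. -/
noncomputable def gbar (G : SimpleGraph V) [DecidableRel G.Adj] {k : ℕ}
    (P : Fin k → Finset V) (i : Fin k) : V → ℝ :=
  fun v => (if v ∈ P i then Real.sqrt (G.degree v) else 0) / Real.sqrt (vol G (P i))

/-- Coefficients `α_j^{(i)} = ⟨ḡ_i, f_j⟩` of `ḡ_i` in the eigenbasis. -/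
noncomputable def alpha (G : SimpleGraph V) [DecidableRel G.Adj] {k : ℕ}
    (P : Fin k → Finset V) (f : Fin (Fintype.card V) → V → ℝ)
    (i : Fin k) (j : Fin (Fintype.card V)) : ℝ :=
  dotV (gbar G P i) (f j)

/-- Projection `f̂_i = ∑_{j=1}^k α_j^{(i)} f_j` of `ḡ_i` onto the first `k` eigenvectors. -/
noncomputable def fhat (G : SimpleGraph V) [DecidableRel G.Adj] {k : ℕ}
    (P : Fin k → Finset V) (f : Fin (Fintype.card V) → V → ℝ) (i : Fin k) : V → ℝ :=
  fun v => ∑ j : Fin (Fintype.card V),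
    if (j : ℕ) < k then alpha G P f i j * f j v else 0

/-- Estimation center `p^{(i)} = μ(P_i)^{-1/2} (β_i^{(1)}, …, β_i^{(k)})`;
here `beta i j` denotes `β_j^{(i)}`. -/
noncomputable def estCenter (G : SimpleGraph V) [DecidableRel G.Adj] {k : ℕ}
    (P : Fin k → Finset V) (beta : Fin k → Fin k → ℝ) (i : Fin k) : Fin k → ℝ :=
  fun j => beta j i / Real.sqrt (vol G (P i))

/-- The quadratic form of the normalized Laplacian as a sum over adjacent pairs. -/
lemma dotV_normLap (G : SimpleGraph V) [DecidableRel G.Adj] (hd : ∀ v : V, 0 < G.degree v)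
    (x : V → ℝ) :
    dotV x ((normLap G).mulVec x) =
      (∑ u, ∑ v, (if G.Adj u v then (1 : ℝ) else 0) *
        (x u / √(G.degree u) - x v / √(G.degree v)) ^ 2) / 2 := by
  have hdeg : ∀ u, ∑ v, (if G.Adj u v then (1 : ℝ) else 0) = G.degree u := fun u => by
    rw [Finset.sum_boole, ← G.card_neighborFinset_eq_degree, G.neighborFinset_eq_filter]
  have hsq : ∀ u, (x u / √(G.degree u)) ^ 2 * G.degree u = x u ^ 2 := fun u => by
    have : (0 : ℝ) < G.degree u := by exact_mod_cast hd u
    rw [div_pow, Real.sq_sqrt this.le]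
    field_simp
  have h1 : ∑ u, ∑ v, (if G.Adj u v then (1 : ℝ) else 0) * (x u / √(G.degree u)) ^ 2 =
      ∑ u, x u ^ 2 := by
    refine Finset.sum_congr rfl fun u _ => ?_
    rw [← Finset.sum_mul, hdeg, mul_comm, hsq]
  have h2 : ∑ u, ∑ v, (if G.Adj u v then (1 : ℝ) else 0) * (x v / √(G.degree v)) ^ 2 =
      ∑ u, x u ^ 2 := by
    rw [Finset.sum_comm, ← h1]
    simp only [G.adj_comm]
  have hL : dotV x ((normLap G).mulVec x) = ∑ u, x u ^ 2 -
      ∑ u, ∑ v, (if G.Adj u v then (1 : ℝ) else 0) *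
        (x u / √(G.degree u) * (x v / √(G.degree v))) := by
    rw [← Finset.sum_sub_distrib]
    refine Finset.sum_congr rfl fun u _ => ?_
    rw [normLap, Matrix.sub_mulVec, Matrix.one_mulVec, Pi.sub_apply, mul_sub, ← sq,
      Matrix.mulVec_eq_sum, Finset.sum_apply, Finset.mul_sum]
    congr 1
    simp only [Pi.smul_apply, MulOpposite.smul_eq_mul_unop, MulOpposite.unop_op,
      Matrix.transpose_apply, Matrix.mul_diagonal, Matrix.diagonal_mul,
      SimpleGraph.adjMatrix_apply]
    exact Finset.sum_congr rfl fun v _ => by ring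
  have h3 : ∑ u, ∑ v, (if G.Adj u v then (1 : ℝ) else 0) *
        (x u / √(G.degree u) - x v / √(G.degree v)) ^ 2 =
      ∑ u, ∑ v, (if G.Adj u v then (1 : ℝ) else 0) * (x u / √(G.degree u)) ^ 2 +
      ∑ u, ∑ v, (if G.Adj u v then (1 : ℝ) else 0) * (x v / √(G.degree v)) ^ 2 -
      2 * ∑ u, ∑ v, (if G.Adj u v then (1 : ℝ) else 0) *
        (x u / √(G.degree u) * (x v / √(G.degree v))) := by
    simp only [Finset.mul_sum, ← Finset.sum_add_distrib, ← Finset.sum_sub_distrib]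
    exact Finset.sum_congr rfl fun u _ => Finset.sum_congr rfl fun v _ => by ring
  rw [hL, h3, h1, h2]
  ring

lemma dotV_normLap_nonneg (G : SimpleGraph V) [DecidableRel G.Adj]
    (hd : ∀ v : V, 0 < G.degree v) (x : V → ℝ) : 0 ≤ dotV x ((normLap G).mulVec x) := by
  rw [dotV_normLap G hd]
  refine div_nonneg (Finset.sum_nonneg fun u _ => Finset.sum_nonneg fun v _ => ?_) (by norm_num)
  split_ifs <;> positivity

lemma dotV_normLap_comm (G : SimpleGraph V) [DecidableRel G.Adj] (x y : V → ℝ) :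
    dotV ((normLap G).mulVec x) y = dotV x ((normLap G).mulVec y) := by
  have hT : (normLap G)ᵀ = normLap G := by
    simp [normLap, Matrix.transpose_mul, Matrix.mul_assoc]
  change (normLap G).mulVec x ⬝ᵥ y = x ⬝ᵥ (normLap G).mulVec y
  rw [Matrix.dotProduct_mulVec, ← Matrix.mulVec_transpose, hT]

/-- The Rayleigh quotient of a normalized indicator vector is the conductance of the set. -/
lemma dotV_normLap_gbar (G : SimpleGraph V) [DecidableRel G.Adj]
    (hd : ∀ v : V, 0 < G.degree v) {k : ℕ} (P : Fin k → Finset V) (i : Fin k) :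
    dotV (gbar G P i) ((normLap G).mulVec (gbar G P i)) = conductance G (P i) := by
  rw [dotV_normLap G hd]
  have hg : ∀ v, gbar G P i v / √(G.degree v) =
      (if v ∈ P i then (1 : ℝ) else 0) / √(vol G (P i)) := fun v => by
    have : (0 : ℝ) < √(G.degree v) := Real.sqrt_pos.2 (by exact_mod_cast hd v)
    unfold gbar
    split_ifs
    · field_simp
    · simp
  have hterm : ∀ u v, (if G.Adj u v then (1 : ℝ) else 0) *
        (gbar G P i u / √(G.degree u) - gbar G P i v / √(G.degree v)) ^ 2 =
      ((if u ∈ P i then (if v ∈ (P i)ᶜ then (if G.Adj u v then (1 : ℝ) else 0) else 0) else 0) +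
       (if v ∈ P i then (if u ∈ (P i)ᶜ then (if G.Adj v u then (1 : ℝ) else 0) else 0) else 0)) /
        vol G (P i) := fun u v => by
    rw [hg, hg, ← sub_div, div_pow, Real.sq_sqrt (Nat.cast_nonneg _), ← mul_div_assoc]
    congr 1
    by_cases hu : u ∈ P i <;> by_cases hv : v ∈ P i <;> simp [hu, hv, G.adj_comm]
  have hcut : ∑ u, ∑ v, (if u ∈ P i then
      (if v ∈ (P i)ᶜ then (if G.Adj u v then (1 : ℝ) else 0) else 0) else 0) =
      cut G (P i) (P i)ᶜ := by
    simp only [cut, Nat.cast_sum]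
    rw [← Finset.sum_filter_add_sum_filter_not univ (· ∈ P i)]
    rw [Finset.sum_eq_zero (s := univ.filter (¬ · ∈ P i)) fun u hu => by
      simp [(Finset.mem_filter.1 hu).2], add_zero]
    rw [Finset.filter_mem_eq_inter, Finset.univ_inter]
    refine Finset.sum_congr rfl fun u hu => ?_
    simp only [hu, if_true]
    rw [Finset.sum_ite_mem, Finset.univ_inter, Finset.sum_boole]
  simp only [hterm, ← Finset.sum_div, Finset.sum_add_distrib]
  rw [Finset.sum_comm (f := fun u v => if v ∈ P i then
    (if u ∈ (P i)ᶜ then (if G.Adj v u then (1 : ℝ) else 0) else 0) else 0), hcut, conductance]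
  ring

/-- Parseval's identity for a complete orthonormal family of eigenvectors. -/
lemma EigenData.parseval {G : SimpleGraph V} [DecidableRel G.Adj]
    {f : Fin (Fintype.card V) → V → ℝ} {lam : Fin (Fintype.card V) → ℝ}
    (hf : EigenData G f lam) (x y : V → ℝ) :
    dotV x y = ∑ j, dotV x (f j) * dotV y (f j) := by
  have h1 : Matrix.of f * (Matrix.of f)ᵀ = 1 := by
    ext i j
    simpa [Matrix.mul_apply, Matrix.one_apply, dotV] using hf.ortho i j
  have h2 : (Matrix.of f)ᵀ * Matrix.of f = 1 :=
    (Matrix.mul_eq_one_comm_of_card_eq _ _ _ (by simp)).1 h1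
  have h3 : ∀ z : V → ℝ, (fun j => dotV z (f j)) = (Matrix.of f).mulVec z := fun z => by
    ext j
    simp [dotV, Matrix.mulVec, dotProduct, mul_comm]
  change x ⬝ᵥ y = (fun j => dotV x (f j)) ⬝ᵥ (fun j => dotV y (f j))
  rw [h3, h3, Matrix.dotProduct_mulVec, ← Matrix.mulVec_transpose, Matrix.mulVec_mulVec, h2,
    Matrix.one_mulVec]

lemma EigenData.lam_nonneg {G : SimpleGraph V} [DecidableRel G.Adj]
    {f : Fin (Fintype.card V) → V → ℝ} {lam : Fin (Fintype.card V) → ℝ}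
    (hf : EigenData G f lam) (hd : ∀ v : V, 0 < G.degree v) (j : Fin (Fintype.card V)) :
    0 ≤ lam j := by
  have h := dotV_normLap_nonneg G hd (f j)
  have h1 : dotV (f j) (lam j • f j) = lam j * dotV (f j) (f j) := by
    simp only [dotV, Finset.mul_sum, Pi.smul_apply, smul_eq_mul]
    exact Finset.sum_congr rfl fun v _ => by ring
  rw [hf.eig, h1, hf.ortho] at h
  simpa using h

/-- Spectral expansion of the Rayleigh quotient of a normalized indicator vector. -/
lemma EigenData.sum_lam_mul_alpha_sq {G : SimpleGraph V} [DecidableRel G.Adj]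
    {f : Fin (Fintype.card V) → V → ℝ} {lam : Fin (Fintype.card V) → ℝ}
    (hf : EigenData G f lam) (hd : ∀ v : V, 0 < G.degree v) {k : ℕ}
    (P : Fin k → Finset V) (i : Fin k) :
    ∑ j, lam j * alpha G P f i j ^ 2 = conductance G (P i) := by
  rw [← dotV_normLap_gbar G hd, hf.parseval]
  refine Finset.sum_congr rfl fun j _ => ?_
  rw [dotV_normLap_comm, hf.eig]
  have h1 : dotV (gbar G P i) (lam j • f j) = lam j * dotV (gbar G P i) (f j) := by
    simp only [dotV, Finset.mul_sum, Pi.smul_apply, smul_eq_mul]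
    exact Finset.sum_congr rfl fun v _ => by ring
  rw [h1, alpha]
  ring

lemma vol_pos {V : Type} [Fintype V] (G : SimpleGraph V) [DecidableRel G.Adj]
    (hd : ∀ v : V, 0 < G.degree v)
    {S : Finset V} (hS : S.Nonempty) : (0 : ℝ) < vol G S := by
  exact_mod_cast Finset.sum_pos (fun v _ => hd v) hS

lemma sum_gbar_sq (G : SimpleGraph V) [DecidableRel G.Adj] (hd : ∀ v : V, 0 < G.degree v)
    {k : ℕ} {P : Fin k → Finset V} {i : Fin k} (hS : (P i).Nonempty) :
    ∑ v ∈ P i, gbar G P i v ^ 2 = 1 := by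
  have h : ∀ v ∈ P i, gbar G P i v ^ 2 = (G.degree v : ℝ) / vol G (P i) := fun v hv => by
    rw [gbar, if_pos hv, div_pow, Real.sq_sqrt (Nat.cast_nonneg _),
      Real.sq_sqrt (Nat.cast_nonneg _)]
  rw [Finset.sum_congr rfl h, ← Finset.sum_div, ← Nat.cast_sum]
  exact div_self (vol_pos G hd hS).ne'

lemma dotV_gbar (G : SimpleGraph V) [DecidableRel G.Adj] {k : ℕ} (P : Fin k → Finset V)
    (i : Fin k) (y : V → ℝ) : dotV (gbar G P i) y = ∑ v ∈ P i, gbar G P i v * y v := by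
  refine (Finset.sum_subset (Finset.subset_univ _) fun v _ hv => ?_).symm
  simp [gbar, hv]

/-- The mass of a normalized indicator vector outside the first `k` eigenvectors is controlled
by its conductance. -/
lemma EigenData.lam_mul_one_sub_le {G : SimpleGraph V} [DecidableRel G.Adj]
    {f : Fin (Fintype.card V) → V → ℝ} {lam : Fin (Fintype.card V) → ℝ}
    (hf : EigenData G f lam) (hd : ∀ v : V, 0 < G.degree v) {k : ℕ}
    (hkn : k < Fintype.card V) {P : Fin k → Finset V} {i : Fin k} (hS : (P i).Nonempty) :
    lam ⟨k, hkn⟩ * (1 - ∑ j : Fin k, alpha G P f i (Fin.castLE hkn.le j) ^ 2) ≤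
      conductance G (P i) := by
  have hone : ∑ j, alpha G P f i j ^ 2 = 1 := by
    have h := hf.parseval (gbar G P i) (gbar G P i)
    rw [dotV_gbar G P i (gbar G P i)] at h
    simp only [← sq] at h
    rw [sum_gbar_sq G hd hS] at h
    exact h.symm
  have himg : ∑ j : Fin k, alpha G P f i (Fin.castLE hkn.le j) ^ 2 =
      ∑ j : Fin (Fintype.card V), if (j : ℕ) < k then alpha G P f i j ^ 2 else 0 := by
    rw [← Finset.sum_filter]
    refine Finset.sum_bij (fun j _ => Fin.castLE hkn.le j) (by simp) (by simp) ?_ (by simp)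
    intro b hb
    exact ⟨⟨b, (Finset.mem_filter.1 hb).2⟩, Finset.mem_univ _, rfl⟩
  rw [← hf.sum_lam_mul_alpha_sq hd P i, himg, ← hone, ← Finset.sum_sub_distrib, Finset.mul_sum]
  refine Finset.sum_le_sum fun j _ => ?_
  split_ifs with h
  · rw [sub_self, mul_zero]
    exact mul_nonneg (hf.lam_nonneg hd j) (sq_nonneg _)
  · rw [sub_zero]
    exact mul_le_mul_of_nonneg_right (hf.mono (Fin.mk_le_of_le_val (not_lt.1 h))) (sq_nonneg _)

lemma kmCost_nonneg {V : Type} [Fintype V] (G : SimpleGraph V) [DecidableRel G.Adj]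
    (f : Fin (Fintype.card V) → V → ℝ) {k : ℕ} (hk : k ≤ Fintype.card V) {ℓ : ℕ}
    (A : Fin ℓ → Finset V) (c : Fin ℓ → Fin k → ℝ) : 0 ≤ kmCost G f hk A c := by
  unfold kmCost
  positivity

lemma kmOpt_le_kmCost {V : Type} [Fintype V] (G : SimpleGraph V) [DecidableRel G.Adj]
    (f : Fin (Fintype.card V) → V → ℝ) {k : ℕ} (hk : k ≤ Fintype.card V) {ℓ : ℕ}
    {A : Fin ℓ → Finset V} (c : Fin ℓ → Fin k → ℝ)
    (hA : ∀ i j, i ≠ j → Disjoint (A i) (A j)) (hA' : ∀ v : V, ∃ i, v ∈ A i) :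
    kmOpt G f hk ℓ ≤ kmCost G f hk A c := by
  refine csInf_le ⟨0, ?_⟩ ⟨A, c, hA, hA', rfl⟩
  rintro _ ⟨A, c, -, -, rfl⟩
  exact kmCost_nonneg G f hk A c

lemma sum_blocks {ℓ : ℕ} {A : Fin ℓ → Finset V}
    (hA : ∀ i j, i ≠ j → Disjoint (A i) (A j)) (hA' : ∀ v : V, ∃ i, v ∈ A i) (g : V → ℝ) :
    ∑ i, ∑ u ∈ A i, g u = ∑ u, g u := by
  rw [← Finset.sum_biUnion fun i _ j _ hij => hA i j hij]
  congr 1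
  ext v
  simpa using hA' v

/-- The cost of clustering by `P`, with the centroids of its blocks as centers. -/
lemma kmCost_centroids {G : SimpleGraph V} [DecidableRel G.Adj]
    {f : Fin (Fintype.card V) → V → ℝ} {lam : Fin (Fintype.card V) → ℝ}
    (hf : EigenData G f lam) (hd : ∀ v : V, 0 < G.degree v) {k : ℕ}
    (hk : k ≤ Fintype.card V) {P : Fin k → Finset V} (hP : IsKWayPartition P) :
    kmCost G f hk P (fun i j => alpha G P f i (Fin.castLE hk j) / √(vol G (P i))) =
      ∑ i, (1 - ∑ j : Fin k, alpha G P f i (Fin.castLE hk j) ^ 2) := by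
  obtain ⟨hne, hdis, hcov⟩ := hP
  have hterm : ∀ i, ∀ u ∈ P i, (G.degree u : ℝ) *
      ∑ j, (Femb G f hk u j - alpha G P f i (Fin.castLE hk j) / √(vol G (P i))) ^ 2 =
      ∑ j, (f (Fin.castLE hk j) u ^ 2 -
        2 * alpha G P f i (Fin.castLE hk j) * (gbar G P i u * f (Fin.castLE hk j) u) +
        alpha G P f i (Fin.castLE hk j) ^ 2 * gbar G P i u ^ 2) := fun i u hu => by
    rw [Finset.mul_sum]
    refine Finset.sum_congr rfl fun j _ => ?_
    have hs : (0 : ℝ) < √(G.degree u) := Real.sqrt_pos.2 (by exact_mod_cast hd u)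
    have hv : (0 : ℝ) < √(vol G (P i)) := Real.sqrt_pos.2 (vol_pos G hd (hne i))
    rw [Femb, gbar, if_pos hu]
    nth_rewrite 1 [← Real.sq_sqrt (Nat.cast_nonneg (G.degree u))]
    field_simp
    ring
  have hsq : ∑ i, ∑ u ∈ P i, ∑ j : Fin k, f (Fin.castLE hk j) u ^ 2 = ∑ _i : Fin k, (1 : ℝ) := by
    rw [sum_blocks hdis hcov, Finset.sum_comm]
    refine Finset.sum_congr rfl fun j _ => ?_
    simpa [dotV, sq] using hf.ortho (Fin.castLE hk j) (Fin.castLE hk j)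
  have hblock : ∀ i, ∑ u ∈ P i, ∑ j : Fin k, (f (Fin.castLE hk j) u ^ 2 -
        2 * alpha G P f i (Fin.castLE hk j) * (gbar G P i u * f (Fin.castLE hk j) u) +
        alpha G P f i (Fin.castLE hk j) ^ 2 * gbar G P i u ^ 2) =
      ∑ u ∈ P i, ∑ j : Fin k, f (Fin.castLE hk j) u ^ 2 -
        ∑ j : Fin k, alpha G P f i (Fin.castLE hk j) ^ 2 := fun i => by
    rw [Finset.sum_comm, Finset.sum_comm (s := P i), ← Finset.sum_sub_distrib]
    refine Finset.sum_congr rfl fun j _ => ?_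
    rw [Finset.sum_add_distrib, Finset.sum_sub_distrib, ← Finset.mul_sum, ← Finset.mul_sum,
      sum_gbar_sq G hd (hne i), ← dotV_gbar, ← alpha]
    ring
  unfold kmCost
  rw [Finset.sum_congr rfl fun i _ => Finset.sum_congr rfl (hterm i),
    Finset.sum_congr rfl fun i _ => hblock i, Finset.sum_sub_distrib, hsq, Finset.sum_sub_distrib]

/-- Clustering an orthonormal `k`-dimensional embedding with fewer than `k` centers costs at
least one: some unit direction is orthogonal to every center. -/
lemma one_le_kmCost {G : SimpleGraph V} [DecidableRel G.Adj]
    {f : Fin (Fintype.card V) → V → ℝ} {lam : Fin (Fintype.card V) → ℝ}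
    (hf : EigenData G f lam) (hd : ∀ v : V, 0 < G.degree v) {k ℓ : ℕ} (hℓ : ℓ < k)
    (hk : k ≤ Fintype.card V) {A : Fin ℓ → Finset V} (c : Fin ℓ → Fin k → ℝ)
    (hA : ∀ i j, i ≠ j → Disjoint (A i) (A j)) (hA' : ∀ v : V, ∃ i, v ∈ A i) :
    1 ≤ kmCost G f hk A c := by
  obtain ⟨x, hx0, hx⟩ : ∃ x : Fin k → ℝ, x ≠ 0 ∧ (Matrix.of c).mulVec x = 0 := by
    have hker : LinearMap.ker (Matrix.of c).mulVecLin ≠ ⊥ :=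
      LinearMap.ker_ne_bot_of_finrank_lt (by simpa using hℓ)
    obtain ⟨x, hx, hx0⟩ := Submodule.exists_mem_ne_zero_of_ne_bot hker
    exact ⟨x, hx0, by simpa using hx⟩
  have hnorm : 0 < ∑ j, x j ^ 2 := by
    obtain ⟨j, hj⟩ := Function.ne_iff.1 hx0
    exact Finset.sum_pos' (fun _ _ => sq_nonneg _) ⟨j, Finset.mem_univ _, by
      have : x j ≠ 0 := hj
      positivity⟩
  have hterm : ∀ i u, (∑ j, x j * f (Fin.castLE hk j) u) ^ 2 ≤
      (∑ j, x j ^ 2) * ((G.degree u : ℝ) * ∑ j, (Femb G f hk u j - c i j) ^ 2) := fun i u => by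
    have hs : (0 : ℝ) < √(G.degree u) := Real.sqrt_pos.2 (by exact_mod_cast hd u)
    have hxi : ∑ j, c i j * x j = 0 := congrFun hx i
    have hsum : ∑ j, x j * f (Fin.castLE hk j) u =
        √(G.degree u) * ∑ j, x j * (Femb G f hk u j - c i j) := by
      have : ∑ j, x j * (Femb G f hk u j - c i j) = ∑ j, x j * Femb G f hk u j := by
        simp only [mul_sub, Finset.sum_sub_distrib]
        rw [Finset.sum_congr rfl fun j _ => mul_comm (x j) (c i j), hxi, sub_zero]
      rw [this, Finset.mul_sum]
      refine Finset.sum_congr rfl fun j _ => ?_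
      rw [Femb]
      field_simp
    rw [hsum, mul_pow, Real.sq_sqrt (Nat.cast_nonneg _), mul_left_comm]
    exact mul_le_mul_of_nonneg_left (Finset.sum_mul_sq_le_sq_mul_sq _ _ _) (Nat.cast_nonneg _)
  have hfull : ∑ u, (∑ j, x j * f (Fin.castLE hk j) u) ^ 2 = ∑ j, x j ^ 2 := by
    have hexp : ∀ u, (∑ j, x j * f (Fin.castLE hk j) u) ^ 2 = ∑ i, ∑ j, x i * x j *
        (f (Fin.castLE hk i) u * f (Fin.castLE hk j) u) := fun u => by
      rw [sq, Finset.sum_mul_sum]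
      exact Finset.sum_congr rfl fun i _ => Finset.sum_congr rfl fun j _ => by ring
    simp only [hexp]
    rw [Finset.sum_comm]
    refine Finset.sum_congr rfl fun i _ => ?_
    rw [Finset.sum_comm]
    have hij : ∀ j, ∑ u, x i * x j * (f (Fin.castLE hk i) u * f (Fin.castLE hk j) u) =
        if i = j then x i * x j else 0 := fun j => by
      rw [← Finset.mul_sum]
      have h := hf.ortho (Fin.castLE hk i) (Fin.castLE hk j)
      simp only [dotV, (Fin.castLE_injective hk).eq_iff] at h
      rw [h, mul_ite, mul_one, mul_zero]
    simp only [hij, Finset.sum_ite_eq, Finset.mem_univ, if_true, sq]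
  have hle : ∑ j, x j ^ 2 ≤ (∑ j, x j ^ 2) * kmCost G f hk A c := by
    calc ∑ j, x j ^ 2 = ∑ i, ∑ u ∈ A i, (∑ j, x j * f (Fin.castLE hk j) u) ^ 2 := by
          rw [sum_blocks hA hA', hfull]
      _ ≤ _ := by
          simp only [kmCost, Finset.mul_sum (s := univ (α := Fin ℓ)),
            Finset.mul_sum (s := A _)]
          exact Finset.sum_le_sum fun i _ => Finset.sum_le_sum fun u _ => hterm i u
  exact (le_mul_iff_one_le_right hnorm).1 hle

lemma one_le_kmOpt {G : SimpleGraph V} [DecidableRel G.Adj]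
    {f : Fin (Fintype.card V) → V → ℝ} {lam : Fin (Fintype.card V) → ℝ}
    (hf : EigenData G f lam) (hd : ∀ v : V, 0 < G.degree v) {k ℓ : ℕ} (hℓ0 : 0 < ℓ)
    (hℓ : ℓ < k) (hk : k ≤ Fintype.card V) : 1 ≤ kmOpt G f hk ℓ := by
  refine le_csInf ⟨_, fun i => if i = ⟨0, hℓ0⟩ then univ else ∅, 0, ?_, ?_, rfl⟩ ?_
  · intro i j hij
    by_cases hi : i = ⟨0, hℓ0⟩
    · simp [show j ≠ ⟨0, hℓ0⟩ from fun h => hij (hi.trans h.symm)]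
    · simp [hi]
  · exact fun v => ⟨⟨0, hℓ0⟩, by simp⟩
  · rintro _ ⟨A, c, hA, hA', rfl⟩
    exact one_le_kmCost hf hd hℓ hk c hA hA'

lemma avgCond_eq_zero_of_one (G : SimpleGraph V) [DecidableRel G.Adj] {P : Fin 1 → Finset V}
    (hP : IsKWayPartition P) : avgCond G P = 0 := by
  have h : P 0 = univ := Finset.eq_univ_of_forall fun v => by
    obtain ⟨i, hi⟩ := hP.2.2 v
    rwa [Subsingleton.elim i 0] at hi
  simp [avgCond, conductance, cut, h]

lemma kmOpt_le_div_Psi {G : SimpleGraph V} [DecidableRel G.Adj]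
    {f : Fin (Fintype.card V) → V → ℝ} {lam : Fin (Fintype.card V) → ℝ}
    (hf : EigenData G f lam) (hd : ∀ v : V, 0 < G.degree v) {k : ℕ}
    (hkn : k < Fintype.card V) {P : Fin k → Finset V} (hP : IsKWayPartition P)
    (hlam : 0 < lam ⟨k, hkn⟩) (hk0 : 0 < k) :
    kmOpt G f hkn.le k ≤ k / Psi G lam P hkn := by
  refine (kmOpt_le_kmCost G f hkn.le _ hP.2.1 hP.2.2).trans
    ((kmCost_centroids hf hd hkn.le hP).trans_le ?_)
  have hk : (0 : ℝ) < k := by exact_mod_cast hk0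
  have hR : (k : ℝ) / Psi G lam P hkn = (∑ i, conductance G (P i)) / lam ⟨k, hkn⟩ := by
    rw [Psi, avgCond, div_div_eq_mul_div, mul_div_cancel₀ _ hk.ne']
  rw [hR, le_div_iff₀ hlam, Finset.sum_mul]
  refine Finset.sum_le_sum fun i _ => ?_
  rw [mul_comm]
  exact hf.lam_mul_one_sub_le hd hkn (hP.1 i)

theorem normalized_spectral_embedding_eps_separated
    {V : Type} [Fintype V] [DecidableEq V] (G : SimpleGraph V) [DecidableRel G.Adj]
    (hd : ∀ v : V, 0 < G.degree v)
    {k : ℕ} (hkn : k < Fintype.card V)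
    (f : Fin (Fintype.card V) → V → ℝ) (lam : Fin (Fintype.card V) → ℝ)
    (hf : EigenData G f lam)
    (P : Fin k → Finset V) (hP : AchievesRhoAvr G P)
    (δ : ℝ) (hδ0 : 0 < δ) (hδ1 : δ ≤ 1 / 2) (hkδ : (k : ℝ) / δ ≥ (10 : ℝ) ^ 9)
    (hPsi : Psi G lam P hkn = (20 : ℝ) ^ 4 * (k : ℝ) ^ 3 / δ) :
    kmOpt G f hkn.le k ≤ ((6 : ℝ) / 10 ^ 7) ^ 2 * kmOpt G f hkn.le (k - 1) ∧
      kmOpt G f hkn.le (k - 1) ≥ 1 / 12 - 2 * δ / (20 : ℝ) ^ 4 / (k : ℝ) ∧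
      kmOpt G f hkn.le k ≤ 2 * (k : ℝ) ^ 2 / Psi G lam P hkn := by
  have hk0 : 0 < k := by
    rcases Nat.eq_zero_or_pos k with rfl | h
    · norm_num at hkδ
    · exact h
  have hkR : (1 : ℝ) ≤ k := by exact_mod_cast hk0
  have hPsi0 : 0 < Psi G lam P hkn := by
    rw [hPsi]
    positivity
  have hk1 : k ≠ 1 := by
    rintro rfl
    rw [Psi, avgCond_eq_zero_of_one G hP.1, div_zero] at hPsi0
    exact hPsi0.false
  have hlam : 0 < lam ⟨k, hkn⟩ :=
    (hf.lam_nonneg hd _).lt_of_ne fun h => by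
      rw [Psi, ← h, zero_div] at hPsi0
      exact hPsi0.false
  have hup : kmOpt G f hkn.le k ≤ k / Psi G lam P hkn :=
    kmOpt_le_div_Psi hf hd hkn hP.1 hlam hk0
  have hlow : 1 ≤ kmOpt G f hkn.le (k - 1) :=
    one_le_kmOpt hf hd (by omega) (by omega) hkn.le
  have hup' : kmOpt G f hkn.le k ≤ 2 * (k : ℝ) ^ 2 / Psi G lam P hkn :=
    hup.trans (div_le_div_of_nonneg_right (by nlinarith) hPsi0.le)
  have hsmall : 2 * (k : ℝ) ^ 2 / Psi G lam P hkn ≤ ((6 : ℝ) / 10 ^ 7) ^ 2 := by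
    rw [hPsi, div_le_iff₀ (by positivity)]
    have h : (k : ℝ) ^ 2 * ((10 : ℝ) ^ 9) ≤ (k : ℝ) ^ 2 * (k / δ) :=
      mul_le_mul_of_nonneg_left hkδ (sq_nonneg _)
    have h' : (20 : ℝ) ^ 4 * (k : ℝ) ^ 3 / δ = 20 ^ 4 * ((k : ℝ) ^ 2 * (k / δ)) := by ring
    rw [h']
    nlinarith [sq_nonneg (k : ℝ)]
  refine ⟨?_, ?_, hup'⟩
  · linarith [mul_le_mul_of_nonneg_left hlow (sq_nonneg ((6 : ℝ) / 10 ^ 7))]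
  · have : 0 ≤ 2 * δ / (20 : ℝ) ^ 4 / (k : ℝ) := by positivity
    linarith

end SpectralClustering
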